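/- After removing the directed edge a⋆ → b, Σ⋆ b b = Σ b b − 2 λ Σ a⋆ b + λ² Σ a⋆ a⋆. -/

import Mathlib

open Matrix

attribute [local instance] Classical.propDecidable

namespace EdgeIntervention

variable {n : ℕ}

/-- Descendants of `b` (including `b`): vertices reachable under the edge relation of `D`. -/
def desc (D : Set (Fin n × Fin n)) (b : Fin n) : Set (Fin n) :=
  {c | Relation.ReflTransGen (fun i j => (i, j) ∈ D) b c}

/-- Ancestors of `c` (including `c`). -/
def anc (D : Set (Fin n × Fin n)) (c : Fin n) : Set (Fin n) :=
  {i | c ∈ desc D i}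

/-- Descendants of `b` in the induced subgraph on `W`. -/
def descW (D : Set (Fin n × Fin n)) (W : Set (Fin n)) (b : Fin n) : Set (Fin n) :=
  {c | Relation.ReflTransGen (fun i j => (i, j) ∈ D ∧ i ∈ W ∧ j ∈ W) b c}

/-- District of `b` in the induced subgraph on `W`. -/
def disW (B : Set (Fin n × Fin n)) (W : Set (Fin n)) (b : Fin n) : Set (Fin n) :=
  {c | Relation.ReflTransGen (fun i j => (i, j) ∈ B ∧ i ∈ W ∧ j ∈ W) b c}

/-- Markov blanket of `b` in the induced subgraph on `W`. -/
def mbW (D B : Set (Fin n × Fin n)) (W : Set (Fin n)) (b : Fin n) : Set (Fin n) :=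
  (disW B W b ∪ {i | i ∈ W ∧ ∃ d ∈ disW B W b, (i, d) ∈ D}) \ {b}

/-- `Λ` is supported on the directed edge set `D`. -/
def DSupported (D : Set (Fin n × Fin n)) (Λ : Matrix (Fin n) (Fin n) ℝ) : Prop :=
  ∀ i j, (i, j) ∉ D → Λ i j = 0

/-- `Ω` is compatible with the bidirected edge set `B`: symmetric, positive definite,
and vanishing off the diagonal and off `B`. -/
def BCompatible (B : Set (Fin n × Fin n)) (Ω : Matrix (Fin n) (Fin n) ℝ) : Prop :=
  Ω.IsSymm ∧ Ω.PosDef ∧ ∀ i j, i ≠ j → (i, j) ∉ B → Ω i j = 0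

/-- The covariance matrix `Σ = ((1 - Λ)⁻¹)ᵀ * Ω * (1 - Λ)⁻¹` of the linear SEM. -/
noncomputable def cov (Λ Ω : Matrix (Fin n) (Fin n) ℝ) : Matrix (Fin n) (Fin n) ℝ :=
  ((1 - Λ)⁻¹)ᵀ * Ω * (1 - Λ)⁻¹

/-- Sum over all directed paths from `i` to `j` of their weights.  A path with `k` edges is
encoded as `f : Fin (k+1) → Fin n` with all steps in `D`; since edges strictly increase,
every directed path has at most `n` edges, so `k` ranges over `Finset.range (n+1)`. -/
noncomputable def pathSum (D : Set (Fin n × Fin n)) (Λ : Matrix (Fin n) (Fin n) ℝ)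
    (i j : Fin n) : ℝ :=
  ∑ k ∈ Finset.range (n + 1),
    ∑ f ∈ Finset.univ.filter
        (fun f : Fin (k + 1) → Fin n =>
          f 0 = i ∧ f (Fin.last k) = j ∧ ∀ t : Fin k, (f t.castSucc, f t.succ) ∈ D),
      ∏ t : Fin k, Λ (f t.castSucc) (f t.succ)

/-- Conditional covariance `σ_{vw·S} = Σ v w − Σ_{vS} (Σ_{SS})⁻¹ Σ_{Sw}`. -/
noncomputable def condCov (Cov : Matrix (Fin n) (Fin n) ℝ) (S : Set (Fin n))
    (v w : Fin n) : ℝ :=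
  letI := (Set.toFinite S).fintype
  Cov v w - ∑ i : S, ∑ j : S,
    Cov v i.val * (Cov.submatrix (Subtype.val : S → Fin n) Subtype.val)⁻¹ i j * Cov j.val w

/-- Regression coefficient `β_{vw·S} = σ_{vw·S} / σ_{vv·S}`. -/
noncomputable def regCoef (Cov : Matrix (Fin n) (Fin n) ℝ) (S : Set (Fin n))
    (v w : Fin n) : ℝ :=
  condCov Cov S v w / condCov Cov S v v

/-- The matrix obtained from `Λ` by setting the `(a,b)` entry to `0`
(removal of the directed edge `a → b`). -/
def removeEdge (Λ : Matrix (Fin n) (Fin n) ℝ) (a b : Fin n) : Matrix (Fin n) (Fin n) ℝ :=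
  Matrix.of fun i j => if i = a ∧ j = b then 0 else Λ i j

/-- The matrix obtained from `Ω` by setting the `(a,b)` and `(b,a)` entries to `0`
(removal of the bidirected edge `a ↔ b`). -/
def removeBi (Ω : Matrix (Fin n) (Fin n) ℝ) (a b : Fin n) : Matrix (Fin n) (Fin n) ℝ :=
  Matrix.of fun i j => if (i = a ∧ j = b) ∨ (i = b ∧ j = a) then 0 else Ω i j

/-- `1 - Λ` is upper triangular when `Λ` is strictly upper triangular. -/
theorem blockTriangular_one_sub {n : ℕ} {Λ : Matrix (Fin n) (Fin n) ℝ}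
    (hΛ : ∀ i j, j ≤ i → Λ i j = 0) : (1 - Λ).BlockTriangular id := fun i j hij => by
  have hji : j < i := hij
  simp [ne_of_gt hji, hΛ i j hji.le]

/-- `1 - Λ` is invertible when `Λ` is strictly upper triangular. -/
theorem isUnit_det_one_sub {n : ℕ} {Λ : Matrix (Fin n) (Fin n) ℝ}
    (hΛ : ∀ i j, j ≤ i → Λ i j = 0) : IsUnit (1 - Λ).det := by
  rw [det_of_isUpperTriangular (blockTriangular_one_sub hΛ)]
  simp [hΛ]

/-- The inverse of `1 - Λ` has unit diagonal when `Λ` is strictly upper triangular. -/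
theorem inv_one_sub_apply_self {n : ℕ} {Λ : Matrix (Fin n) (Fin n) ℝ}
    (hΛ : ∀ i j, j ≤ i → Λ i j = 0) (b : Fin n) : (1 - Λ)⁻¹ b b = 1 := by
  have hdet := isUnit_det_one_sub hΛ
  let := invertibleOfIsUnitDet _ hdet
  have hinv : (1 - Λ)⁻¹.BlockTriangular id :=
    blockTriangular_inv_of_blockTriangular (blockTriangular_one_sub hΛ)
  have hmul : (1 - Λ)⁻¹ = 1 + Λ * (1 - Λ)⁻¹ := by
    have := mul_nonsing_inv _ hdet
    rw [sub_mul, one_mul] at this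
    exact sub_eq_iff_eq_add.mp this
  rw [hmul, Matrix.add_apply, one_apply_eq, mul_apply, Finset.sum_eq_zero, add_zero]
  intro j _
  rcases le_or_gt j b with hj | hj
  · rw [hΛ b j hj, zero_mul]
  · rw [hinv hj, mul_zero]

/-- Removing the edge `a → b` subtracts `Λ a b` times column `a` from column `b` of the
path matrix `(1 - Λ)⁻¹`. -/
theorem inv_one_sub_removeEdge_apply {n : ℕ} {Λ : Matrix (Fin n) (Fin n) ℝ}
    (hΛ : ∀ i j, j ≤ i → Λ i j = 0) (a b i : Fin n) :
    (1 - removeEdge Λ a b)⁻¹ i b = (1 - Λ)⁻¹ i b - Λ a b * (1 - Λ)⁻¹ i a := by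
  have hΛ' : ∀ i j, j ≤ i → removeEdge Λ a b i j = 0 := fun i j hij => by
    simp [removeEdge, hΛ i j hij]
  have hsingle : removeEdge Λ a b = Λ - single a b (Λ a b) := by
    ext i j
    by_cases h : i = a ∧ j = b
    · obtain ⟨rfl, rfl⟩ := h
      simp [removeEdge]
    · have h' : ¬(a = i ∧ b = j) := fun h' => h ⟨h'.1.symm, h'.2.symm⟩
      simp [removeEdge, h, h']
  have hres : (1 - removeEdge Λ a b)⁻¹ =
      (1 - Λ)⁻¹ - (1 - Λ)⁻¹ * single a b (Λ a b) * (1 - removeEdge Λ a b)⁻¹ := by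
    have h₁ := nonsing_inv_mul _ (isUnit_det_one_sub hΛ)
    have h₂ := mul_nonsing_inv _ (isUnit_det_one_sub hΛ')
    have h₃ : single a b (Λ a b) = (1 - removeEdge Λ a b) - (1 - Λ) := by
      rw [hsingle]; abel
    rw [h₃, mul_sub, sub_mul, h₁, Matrix.mul_assoc, h₂, mul_one, one_mul]
    abel
  have hentry := congrFun (congrFun hres i) b
  rw [Matrix.sub_apply, Matrix.mul_assoc, mul_apply, Finset.sum_eq_single a] at hentry
  · rw [hentry, single_mul_apply_same, inv_one_sub_apply_self hΛ']
    ring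
  · intro j _ hj
    rw [single_mul_apply_of_ne _ _ _ _ _ hj, mul_zero]
  · simp

/-- An entry of the covariance matrix is the bilinear form of `Ω` at two columns of the
path matrix. -/
theorem cov_apply {n : ℕ} (Λ Ω : Matrix (Fin n) (Fin n) ℝ) (i j : Fin n) :
    cov Λ Ω i j = (1 - Λ)⁻¹.col i ⬝ᵥ Ω *ᵥ (1 - Λ)⁻¹.col j := by
  rw [cov, Matrix.mul_assoc]
  rfl

/-- The covariance matrix is symmetric. -/
theorem cov_isSymm {n : ℕ} (Λ : Matrix (Fin n) (Fin n) ℝ) {Ω : Matrix (Fin n) (Fin n) ℝ}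
    (hΩ : Ω.IsSymm) : (cov Λ Ω).IsSymm := by
  rw [Matrix.IsSymm, cov, transpose_mul, transpose_mul, transpose_transpose, hΩ.eq,
    Matrix.mul_assoc]

/-- after removing the directed edge `a⋆ → b`,
`Σ⋆ b b = Σ b b − 2 λ Σ a⋆ b + λ² Σ a⋆ a⋆`. -/
theorem remove_edge_cov_b_b (n : ℕ) (D B : Set (Fin n × Fin n))
    (hD : ∀ i j : Fin n, (i, j) ∈ D → i < j)
    (hBsymm : ∀ i j : Fin n, (i, j) ∈ B → (j, i) ∈ B)
    (hBirr : ∀ i : Fin n, (i, i) ∉ B)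
    (Λ Ω : Matrix (Fin n) (Fin n) ℝ)
    (hΛ : DSupported D Λ) (hΩ : BCompatible B Ω)
    (astar b : Fin n) (hab : (astar, b) ∈ D) :
    cov (removeEdge Λ astar b) Ω b b
      = cov Λ Ω b b - 2 * Λ astar b * cov Λ Ω astar b
        + (Λ astar b) ^ 2 * cov Λ Ω astar astar := by
  have hlt : ∀ i j, j ≤ i → Λ i j = 0 := fun i j hij =>
    hΛ i j fun h => hij.not_gt (hD i j h)
  have hcol : (1 - removeEdge Λ astar b)⁻¹.col b =
      (1 - Λ)⁻¹.col b - Λ astar b • (1 - Λ)⁻¹.col astar :=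
    funext (inv_one_sub_removeEdge_apply hlt astar b)
  have hsymm : cov Λ Ω b astar = cov Λ Ω astar b := (cov_isSymm Λ hΩ.1).apply astar b
  rw [cov_apply, hcol]
  simp only [mulVec_sub, mulVec_smul, sub_dotProduct, dotProduct_sub, smul_dotProduct,
    dotProduct_smul, smul_eq_mul, ← cov_apply, hsymm]
  ring

end EdgeIntervention
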